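/- arXiv:1105.1615 — 2 statements merged into one kernel-verified Lean document; each statement's English description precedes it below -/
import Mathlib

section
/- Let (X,A), (Y,B), (Z,C) be Hilbert bimodules and let (ψ_X,ψ_A):(X,A)→(Z,C) and (ω_Y,ω_B):(Y,B)→(Z,C) be morphisms. Then the restricted direct sum X⊕_Z Y := {(ξ,η) ∈ X⊕Y : ψ_X(ξ) = ω_Y(η)} over the pullback C*-algebra A⊕_C B := {(a,b) ∈ A⊕B : ψ_A(a) = ω_B(b)}, with coordinatewise actions (a,b)·(ξ,η) = (a·ξ, b·η) and (ξ,η)·(a,b) = (ξ·a, η·b) and inner products ⟨(α,β),(ξ,η)⟩ = (⟨α,ξ⟩_X, ⟨β,η⟩_Y) and _⟨(α,β),(ξ,η)⟩ = (_X⟨α,ξ⟩, _Y⟨β,η⟩), is a Hilbert bimodule (X⊕_Z Y, A⊕_C B), and the coordinate projections (p_X,p_A):(X⊕_Z Y, A⊕_C B)→(X,A) and (p_Y,p_B):(X⊕_Z Y, A⊕_C B)→(Y,B) are morphisms of Hilbert bimodules. -/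
/-! Basic definitions: Hilbert bimodules over C*-algebras, morphisms, extensions. -/

noncomputable section

open scoped ComplexConjugate

/-- A Hilbert bimodule `(X, A)` over a C*-algebra `A`: `X` is simultaneously a right and a
left Hilbert `A`-module (with nondegenerate actions) satisfying
`_X⟨ξ, η⟩ ⬝ ζ = ξ ⬝ ⟨η, ζ⟩_X`.  Positivity of the inner products is expressed by the
(equivalent) requirement of being of the form `star b * b`. -/
structure HilbertBimodule (A : Type*) (X : Type*)
    [NonUnitalNormedRing A] [StarRing A] [NormedSpace ℂ A]
    [NormedAddCommGroup X] [NormedSpace ℂ X] where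
  /-- the right action of `A` on `X` -/
  rsmul : X → A → X
  /-- the left action of `A` on `X` -/
  lsmul : A → X → X
  /-- the `A`-valued right inner product `⟨·,·⟩_X` -/
  rinn : X → X → A
  /-- the `A`-valued left inner product `_X⟨·,·⟩` -/
  linn : X → X → A
  /-- `A` is a C*-algebra -/
  cstarA : CStarRing A
  towerA : IsScalarTower ℂ A A
  smulCommA : SMulCommClass ℂ A A
  starModA : StarModule ℂ A
  completeA : CompleteSpace A
  /-- `X` is a Banach space -/
  completeX : CompleteSpace X
  rsmul_add_left : ∀ ξ η a, rsmul (ξ + η) a = rsmul ξ a + rsmul η a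
  rsmul_add_right : ∀ ξ a b, rsmul ξ (a + b) = rsmul ξ a + rsmul ξ b
  rsmul_mul : ∀ ξ a b, rsmul ξ (a * b) = rsmul (rsmul ξ a) b
  rsmul_smul_left : ∀ (c : ℂ) ξ a, rsmul (c • ξ) a = c • rsmul ξ a
  rsmul_smul_right : ∀ (c : ℂ) ξ a, rsmul ξ (c • a) = c • rsmul ξ a
  lsmul_add_left : ∀ a b ξ, lsmul (a + b) ξ = lsmul a ξ + lsmul b ξ
  lsmul_add_right : ∀ a ξ η, lsmul a (ξ + η) = lsmul a ξ + lsmul a η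
  lsmul_mul : ∀ a b ξ, lsmul (a * b) ξ = lsmul a (lsmul b ξ)
  lsmul_smul_left : ∀ (c : ℂ) a ξ, lsmul (c • a) ξ = c • lsmul a ξ
  lsmul_smul_right : ∀ (c : ℂ) a ξ, lsmul a (c • ξ) = c • lsmul a ξ
  bimodule_assoc : ∀ a ξ b, rsmul (lsmul a ξ) b = lsmul a (rsmul ξ b)
  rinn_add_right : ∀ ξ η ζ, rinn ξ (η + ζ) = rinn ξ η + rinn ξ ζ
  rinn_smul_right : ∀ (c : ℂ) ξ η, rinn ξ (c • η) = c • rinn ξ η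
  rinn_rsmul : ∀ ξ η a, rinn ξ (rsmul η a) = rinn ξ η * a
  rinn_star : ∀ ξ η, rinn η ξ = star (rinn ξ η)
  /-- positivity: `⟨ξ, ξ⟩_X ≥ 0` -/
  rinn_nonneg : ∀ ξ, ∃ a, rinn ξ ξ = star a * a
  rinn_norm : ∀ ξ, ‖ξ‖ ^ 2 = ‖rinn ξ ξ‖
  linn_add_left : ∀ ξ η ζ, linn (ξ + η) ζ = linn ξ ζ + linn η ζ
  linn_smul_left : ∀ (c : ℂ) ξ η, linn (c • ξ) η = c • linn ξ η
  linn_lsmul : ∀ a ξ η, linn (lsmul a ξ) η = a * linn ξ η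
  linn_star : ∀ ξ η, linn η ξ = star (linn ξ η)
  /-- positivity: `_X⟨ξ, ξ⟩ ≥ 0` -/
  linn_nonneg : ∀ ξ, ∃ a, linn ξ ξ = star a * a
  linn_norm : ∀ ξ, ‖ξ‖ ^ 2 = ‖linn ξ ξ‖
  /-- nondegeneracy of the right action -/
  rsmul_nondegenerate :
    closure (↑(Submodule.span ℂ {x : X | ∃ ξ a, x = rsmul ξ a}) : Set X) = Set.univ
  /-- nondegeneracy of the left action -/
  lsmul_nondegenerate :
    closure (↑(Submodule.span ℂ {x : X | ∃ a ξ, x = lsmul a ξ}) : Set X) = Set.univ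
  /-- the bimodule condition `_X⟨ξ, η⟩ ⬝ ζ = ξ ⬝ ⟨η, ζ⟩_X` -/
  compat : ∀ ξ η ζ, lsmul (linn ξ η) ζ = rsmul ξ (rinn η ζ)

namespace HilbertBimodule

variable {A X : Type*}
    [NonUnitalNormedRing A] [StarRing A] [NormedSpace ℂ A]
    [NormedAddCommGroup X] [NormedSpace ℂ X]

/-- A Hilbert bimodule is *full* if both inner products have dense span in `A`. -/
def Full (hb : HilbertBimodule A X) : Prop :=
  closure (↑(Submodule.span ℂ {a : A | ∃ ξ η, a = hb.rinn ξ η}) : Set A) = Set.univ ∧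
  closure (↑(Submodule.span ℂ {a : A | ∃ ξ η, a = hb.linn ξ η}) : Set A) = Set.univ

end HilbertBimodule

/-- A morphism of Hilbert bimodules `(X, A) → (Y, B)`: a linear map `X → Y` together with a
`*`-homomorphism `A → B` intertwining both actions and both inner products. -/
structure HBMorphism {A X B Y : Type*}
    [NonUnitalNormedRing A] [StarRing A] [NormedSpace ℂ A]
    [NormedAddCommGroup X] [NormedSpace ℂ X]
    [NonUnitalNormedRing B] [StarRing B] [NormedSpace ℂ B]
    [NormedAddCommGroup Y] [NormedSpace ℂ Y]
    (hb : HilbertBimodule A X) (hc : HilbertBimodule B Y) where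
  mapX : X →ₗ[ℂ] Y
  mapA : A →⋆ₙₐ[ℂ] B
  map_rsmul : ∀ ξ a, mapX (hb.rsmul ξ a) = hc.rsmul (mapX ξ) (mapA a)
  map_lsmul : ∀ a ξ, mapX (hb.lsmul a ξ) = hc.lsmul (mapA a) (mapX ξ)
  map_rinn : ∀ ξ η, mapA (hb.rinn ξ η) = hc.rinn (mapX ξ) (mapX η)
  map_linn : ∀ ξ η, mapA (hb.linn ξ η) = hc.linn (mapX ξ) (mapX η)

/-- `(Y, B)` is an extension of `(X, A)`: `A` embeds in `B` as a closed two-sided ideal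
(via `mapA`), together with a morphism of Hilbert bimodules over this inclusion, such that
`A` is invariant with respect to `Y`, i.e. `A ⬝ Y = Y ⬝ A`. -/
structure HBExtension {A X B Y : Type*}
    [NonUnitalNormedRing A] [StarRing A] [NormedSpace ℂ A]
    [NormedAddCommGroup X] [NormedSpace ℂ X]
    [NonUnitalNormedRing B] [StarRing B] [NormedSpace ℂ B]
    [NormedAddCommGroup Y] [NormedSpace ℂ Y]
    (hb : HilbertBimodule A X) (hc : HilbertBimodule B Y)
    extends HBMorphism hb hc where
  injA : Function.Injective mapA
  ideal_left : ∀ (b : B) (a : A), b * mapA a ∈ Set.range mapA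
  ideal_right : ∀ (b : B) (a : A), mapA a * b ∈ Set.range mapA
  closedRange : IsClosed (Set.range mapA)
  invariant :
    closure (↑(Submodule.span ℂ {y : Y | ∃ (a : A) (η : Y), y = hc.lsmul (mapA a) η}) : Set Y) =
    closure (↑(Submodule.span ℂ {y : Y | ∃ (a : A) (η : Y), y = hc.rsmul η (mapA a)}) : Set Y)

/-- The range of `f : A → B` is an *essential* ideal of `B`: it has nonzero intersection
with every nonzero closed two-sided ideal of `B`. -/
def EssentialRange {A B : Type*}
    [NonUnitalNormedRing A] [StarRing A] [NormedSpace ℂ A]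
    [NonUnitalNormedRing B] [StarRing B] [NormedSpace ℂ B]
    (f : A →⋆ₙₐ[ℂ] B) : Prop :=
  ∀ J : TwoSidedIdeal B, IsClosed (J : Set B) → J ≠ ⊥ →
    ∃ b : B, b ∈ J ∧ b ≠ 0 ∧ b ∈ Set.range f

/-- An extension is *essential* if `A` is an essential ideal of `B`. -/
def HBExtension.Essential {A X B Y : Type*}
    [NonUnitalNormedRing A] [StarRing A] [NormedSpace ℂ A]
    [NormedAddCommGroup X] [NormedSpace ℂ X]
    [NonUnitalNormedRing B] [StarRing B] [NormedSpace ℂ B]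
    [NormedAddCommGroup Y] [NormedSpace ℂ Y]
    {hb : HilbertBimodule A X} {hc : HilbertBimodule B Y}
    (ext : HBExtension hb hc) : Prop :=
  EssentialRange ext.mapA

section RestrictedDirectSum

variable {A X B Y C Z : Type*}
    [NonUnitalCStarAlgebra A] [NormedAddCommGroup X] [NormedSpace ℂ X]
    [NonUnitalCStarAlgebra B] [NormedAddCommGroup Y] [NormedSpace ℂ Y]
    [NonUnitalCStarAlgebra C] [NormedAddCommGroup Z] [NormedSpace ℂ Z]

/-- The pullback C*-algebra `A ⊕_C B = {(a, b) : ψ_A(a) = ω_B(b)}`. -/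
def pullbackAlg {hb : HilbertBimodule A X} {hc : HilbertBimodule B Y}
    {hz : HilbertBimodule C Z} (ψ : HBMorphism hb hz) (ω : HBMorphism hc hz) :
    NonUnitalStarSubalgebra ℂ (A × B) where
  carrier := {p | ψ.mapA p.1 = ω.mapA p.2}
  add_mem' := by
    intro p q hp hq
    simp only [Set.mem_setOf_eq, Prod.fst_add, Prod.snd_add, map_add] at *
    rw [hp, hq]
  zero_mem' := by simp [Set.mem_setOf_eq]
  mul_mem' := by
    intro p q hp hq
    simp only [Set.mem_setOf_eq, Prod.fst_mul, Prod.snd_mul, map_mul] at *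
    rw [hp, hq]
  smul_mem' := by
    intro c p hp
    simp only [Set.mem_setOf_eq, Prod.smul_fst, Prod.smul_snd, map_smul] at *
    rw [hp]
  star_mem' := by
    intro p hp
    simp only [Set.mem_setOf_eq, Prod.fst_star, Prod.snd_star, map_star] at *
    rw [hp]

/-- The restricted direct sum `X ⊕_Z Y = {(ξ, η) : ψ_X(ξ) = ω_Y(η)}`. -/
def restrictedDirectSum {hb : HilbertBimodule A X} {hc : HilbertBimodule B Y}
    {hz : HilbertBimodule C Z} (ψ : HBMorphism hb hz) (ω : HBMorphism hc hz) :
    Submodule ℂ (X × Y) where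
  carrier := {p | ψ.mapX p.1 = ω.mapX p.2}
  add_mem' := by
    intro p q hp hq
    simp only [Set.mem_setOf_eq, Prod.fst_add, Prod.snd_add, map_add] at *
    rw [hp, hq]
  zero_mem' := by simp [Set.mem_setOf_eq]
  smul_mem' := by
    intro c p hp
    simp only [Set.mem_setOf_eq, Prod.smul_fst, Prod.smul_snd, map_smul] at *
    rw [hp]

/-- A vector is a limit of the vectors `T e` as soon as their distance to it is given by the
formula valid for the action of a C*-algebra on a Hilbert module. -/
lemma mem_closure_range_of_norm_sq_eq {E : Type*} [NormedAddCommGroup E]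
    {x : E} {p : A} {T : A → E}
    (hT : ∀ e, ‖x - T e‖ ^ 2 = ‖p - p * e - star e * p + star e * p * e‖) :
    x ∈ closure (Set.range T) := by
  let _ : PartialOrder A := CStarAlgebra.spectralOrder A
  have _ : StarOrderedRing A := CStarAlgebra.spectralOrderedRing A
  have hu := CStarAlgebra.increasingApproximateUnit A
  have hlim : Filter.Tendsto (fun e => 2 * ‖p - p * e‖)
      (CStarAlgebra.approximateUnit A) (nhds 0) := by
    simpa using ((tendsto_const_nhds (x := p)).sub (hu.tendsto_mul_left p)).norm.const_mul 2
  have hsq : Filter.Tendsto (fun e => ‖x - T e‖ ^ 2)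
      (CStarAlgebra.approximateUnit A) (nhds 0) := by
    refine squeeze_zero' (.of_forall fun e => by positivity) ?_ hlim
    filter_upwards [hu.eventually_norm] with e he
    have hfac : p - p * e - star e * p + star e * p * e =
        (p - p * e) - star e * (p - p * e) := by
      rw [mul_sub, mul_assoc]; abel
    rw [hT, hfac]
    calc _ ≤ ‖p - p * e‖ + ‖star e‖ * ‖p - p * e‖ :=
          (norm_sub_le _ _).trans (by gcongr; exact norm_mul_le _ _)
      _ ≤ ‖p - p * e‖ + 1 * ‖p - p * e‖ := by rw [norm_star]; gcongr
      _ = 2 * ‖p - p * e‖ := by ring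
  have hnorm : Filter.Tendsto (fun e => ‖T e - x‖)
      (CStarAlgebra.approximateUnit A) (nhds 0) := by
    simpa [Real.sqrt_sq, norm_sub_rev] using hsq.sqrt
  exact mem_closure_of_tendsto (tendsto_iff_norm_sub_tendsto_zero.mpr hnorm)
    (.of_forall fun e => ⟨e, rfl⟩)

/-- Positive elements with the same image under two `*`-homomorphisms have square roots with
the same image. -/
lemma exists_star_mul_self_of_map_eq (f : A →⋆ₙₐ[ℂ] C) (g : B →⋆ₙₐ[ℂ] C) {a : A} {b : B}
    (h : f (star a * a) = g (star b * b)) :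
    ∃ a' b', f a' = g b' ∧ star a * a = star a' * a' ∧ star b * b = star b' * b' := by
  let _ : PartialOrder A := CStarAlgebra.spectralOrder A
  have _ : StarOrderedRing A := CStarAlgebra.spectralOrderedRing A
  let _ : PartialOrder B := CStarAlgebra.spectralOrder B
  have _ : StarOrderedRing B := CStarAlgebra.spectralOrderedRing B
  let _ : PartialOrder C := CStarAlgebra.spectralOrder C
  have _ : StarOrderedRing C := CStarAlgebra.spectralOrderedRing C
  have ha := star_mul_self_nonneg a
  have hb := star_mul_self_nonneg b
  have hsa := CFC.sqrt_nonneg (star a * a)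
  have hsb := CFC.sqrt_nonneg (star b * b)
  refine ⟨CFC.sqrt (star a * a), CFC.sqrt (star b * b), ?_, ?_, ?_⟩
  · rw [← CFC.mul_self_eq_mul_self_iff _ _ (map_nonneg f hsa) (map_nonneg g hsb),
      ← map_mul, ← map_mul, CFC.sqrt_mul_sqrt_self _ ha, CFC.sqrt_mul_sqrt_self _ hb, h]
  · rw [(IsSelfAdjoint.of_nonneg hsa).star_eq, CFC.sqrt_mul_sqrt_self _ ha]
  · rw [(IsSelfAdjoint.of_nonneg hsb).star_eq, CFC.sqrt_mul_sqrt_self _ hb]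

namespace HilbertBimodule

variable (hb : HilbertBimodule A X)

lemma rinn_sub_right (ξ η ζ : X) : hb.rinn ξ (η - ζ) = hb.rinn ξ η - hb.rinn ξ ζ := by
  rw [eq_sub_iff_add_eq, ← hb.rinn_add_right, sub_add_cancel]

lemma rinn_sub_left (ξ η ζ : X) : hb.rinn (ξ - η) ζ = hb.rinn ξ ζ - hb.rinn η ζ := by
  rw [hb.rinn_star ζ, rinn_sub_right, star_sub, ← hb.rinn_star, ← hb.rinn_star]

lemma rinn_rsmul_left (ξ η : X) (a : A) :
    hb.rinn (hb.rsmul ξ a) η = star a * hb.rinn ξ η := by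
  rw [hb.rinn_star η, hb.rinn_rsmul, star_mul, ← hb.rinn_star]

lemma linn_sub_left (ξ η ζ : X) : hb.linn (ξ - η) ζ = hb.linn ξ ζ - hb.linn η ζ := by
  rw [eq_sub_iff_add_eq, ← hb.linn_add_left, sub_add_cancel]

lemma linn_sub_right (ξ η ζ : X) : hb.linn ξ (η - ζ) = hb.linn ξ η - hb.linn ξ ζ := by
  rw [hb.linn_star (η - ζ), linn_sub_left, star_sub, ← hb.linn_star, ← hb.linn_star]

lemma linn_lsmul_right (ξ η : X) (a : A) :
    hb.linn ξ (hb.lsmul a η) = hb.linn ξ η * star a := by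
  rw [hb.linn_star (hb.lsmul a η), hb.linn_lsmul, star_mul, ← hb.linn_star]

lemma rinn_sub_rsmul_self (ξ : X) (a : A) :
    hb.rinn (ξ - hb.rsmul ξ a) (ξ - hb.rsmul ξ a) =
      hb.rinn ξ ξ - hb.rinn ξ ξ * a - star a * hb.rinn ξ ξ + star a * hb.rinn ξ ξ * a := by
  rw [rinn_sub_right, rinn_sub_left, hb.rinn_rsmul, rinn_sub_left, rinn_rsmul_left, sub_mul]
  abel

lemma linn_sub_lsmul_self (ξ : X) (a : A) :
    hb.linn (ξ - hb.lsmul (star a) ξ) (ξ - hb.lsmul (star a) ξ) =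
      hb.linn ξ ξ - hb.linn ξ ξ * a - star a * hb.linn ξ ξ + star a * hb.linn ξ ξ * a := by
  rw [linn_sub_left, linn_sub_right, hb.linn_lsmul, linn_sub_right, linn_lsmul_right, star_star,
    mul_sub, mul_assoc]
  abel

end HilbertBimodule

lemma HBMorphism.norm_mapX_le {hb : HilbertBimodule A X} {hz : HilbertBimodule C Z}
    (ψ : HBMorphism hb hz) (ξ : X) : ‖ψ.mapX ξ‖ ≤ ‖ξ‖ := by
  refine (sq_le_sq₀ (norm_nonneg _) (norm_nonneg _)).mp ?_
  rw [hz.rinn_norm, hb.rinn_norm, ← ψ.map_rinn]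
  exact NonUnitalStarAlgHom.norm_apply_le ψ.mapA _

lemma HBMorphism.continuous_mapX {hb : HilbertBimodule A X} {hz : HilbertBimodule C Z}
    (ψ : HBMorphism hb hz) : Continuous ψ.mapX :=
  AddMonoidHomClass.continuous_of_bound ψ.mapX 1 fun ξ => by simpa using ψ.norm_mapX_le ξ

lemma HBMorphism.continuous_mapA {hb : HilbertBimodule A X} {hz : HilbertBimodule C Z}
    (ψ : HBMorphism hb hz) : Continuous ψ.mapA :=
  AddMonoidHomClass.continuous_of_bound ψ.mapA 1 fun a => by
    simpa using NonUnitalStarAlgHom.norm_apply_le ψ.mapA a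

section Pullback

variable {hb : HilbertBimodule A X} {hc : HilbertBimodule B Y} {hz : HilbertBimodule C Z}
  (ψ : HBMorphism hb hz) (ω : HBMorphism hc hz)

lemma isClosed_pullbackAlg : IsClosed (pullbackAlg ψ ω : Set (A × B)) :=
  isClosed_eq (ψ.continuous_mapA.comp continuous_fst) (ω.continuous_mapA.comp continuous_snd)

lemma isClosed_restrictedDirectSum : IsClosed (restrictedDirectSum ψ ω : Set (X × Y)) :=
  isClosed_eq (ψ.continuous_mapX.comp continuous_fst) (ω.continuous_mapX.comp continuous_snd)

/-- The pullback algebra is a C*-algebra. -/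
abbrev pullbackCStarAlgebra : NonUnitalCStarAlgebra (pullbackAlg ψ ω) :=
  NonUnitalStarSubalgebra.nonUnitalCStarAlgebra _ (h_closed := isClosed_pullbackAlg ψ ω)

namespace RestrictedDirectSum

/-- The coordinatewise right action of the pullback algebra. -/
def rsmul (x : restrictedDirectSum ψ ω) (p : pullbackAlg ψ ω) : restrictedDirectSum ψ ω :=
  ⟨(hb.rsmul x.1.1 p.1.1, hc.rsmul x.1.2 p.1.2), by
    have hx : ψ.mapX x.1.1 = ω.mapX x.1.2 := x.2
    have hp : ψ.mapA p.1.1 = ω.mapA p.1.2 := p.2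
    exact (ψ.map_rsmul _ _).trans (by rw [hx, hp, ω.map_rsmul])⟩

/-- The coordinatewise left action of the pullback algebra. -/
def lsmul (p : pullbackAlg ψ ω) (x : restrictedDirectSum ψ ω) : restrictedDirectSum ψ ω :=
  ⟨(hb.lsmul p.1.1 x.1.1, hc.lsmul p.1.2 x.1.2), by
    have hx : ψ.mapX x.1.1 = ω.mapX x.1.2 := x.2
    have hp : ψ.mapA p.1.1 = ω.mapA p.1.2 := p.2
    exact (ψ.map_lsmul _ _).trans (by rw [hx, hp, ω.map_lsmul])⟩

/-- The coordinatewise right inner product. -/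
def rinn (x y : restrictedDirectSum ψ ω) : pullbackAlg ψ ω :=
  ⟨(hb.rinn x.1.1 y.1.1, hc.rinn x.1.2 y.1.2), by
    have hx : ψ.mapX x.1.1 = ω.mapX x.1.2 := x.2
    have hy : ψ.mapX y.1.1 = ω.mapX y.1.2 := y.2
    exact (ψ.map_rinn _ _).trans (by rw [hx, hy, ω.map_rinn])⟩

/-- The coordinatewise left inner product. -/
def linn (x y : restrictedDirectSum ψ ω) : pullbackAlg ψ ω :=
  ⟨(hb.linn x.1.1 y.1.1, hc.linn x.1.2 y.1.2), by
    have hx : ψ.mapX x.1.1 = ω.mapX x.1.2 := x.2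
    have hy : ψ.mapX y.1.1 = ω.mapX y.1.2 := y.2
    exact (ψ.map_linn _ _).trans (by rw [hx, hy, ω.map_linn])⟩

variable {ψ ω}

lemma ext_coord {x y : restrictedDirectSum ψ ω} (h₁ : x.1.1 = y.1.1) (h₂ : x.1.2 = y.1.2) :
    x = y :=
  Subtype.ext (Prod.ext h₁ h₂)

lemma alg_ext_coord {p q : pullbackAlg ψ ω} (h₁ : p.1.1 = q.1.1) (h₂ : p.1.2 = q.1.2) :
    p = q :=
  Subtype.ext (Prod.ext h₁ h₂)

lemma exists_eq_star_mul_self {p : pullbackAlg ψ ω} (h₁ : ∃ a, p.1.1 = star a * a)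
    (h₂ : ∃ b, p.1.2 = star b * b) : ∃ q, p = star q * q := by
  obtain ⟨a, ha⟩ := h₁
  obtain ⟨b, hb⟩ := h₂
  have hp : ψ.mapA p.1.1 = ω.mapA p.1.2 := p.2
  rw [ha, hb] at hp
  obtain ⟨a', b', h, ha', hb'⟩ := exists_star_mul_self_of_map_eq _ _ hp
  exact ⟨⟨(a', b'), h⟩, alg_ext_coord (ha.trans ha') (hb.trans hb')⟩

lemma norm_sq_eq {x : restrictedDirectSum ψ ω} {p : pullbackAlg ψ ω}
    (h₁ : ‖x.1.1‖ ^ 2 = ‖p.1.1‖) (h₂ : ‖x.1.2‖ ^ 2 = ‖p.1.2‖) : ‖x‖ ^ 2 = ‖p‖ := by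
  change (max ‖x.1.1‖ ‖x.1.2‖) ^ 2 = max ‖p.1.1‖ ‖p.1.2‖
  rw [← h₁, ← h₂]
  exact (pow_left_monotoneOn (n := 2)).map_max (norm_nonneg _) (norm_nonneg _)

lemma rinn_norm (x : restrictedDirectSum ψ ω) : ‖x‖ ^ 2 = ‖rinn ψ ω x x‖ :=
  norm_sq_eq (hb.rinn_norm _) (hc.rinn_norm _)

lemma linn_norm (x : restrictedDirectSum ψ ω) : ‖x‖ ^ 2 = ‖linn ψ ω x x‖ :=
  norm_sq_eq (hb.linn_norm _) (hc.linn_norm _)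

lemma mem_closure_range_rsmul (x : restrictedDirectSum ψ ω) :
    x ∈ closure (Set.range (rsmul ψ ω x)) := by
  let _ := pullbackCStarAlgebra ψ ω
  refine mem_closure_range_of_norm_sq_eq (p := rinn ψ ω x x) fun e => ?_
  rw [rinn_norm]
  exact congrArg norm
    (alg_ext_coord (hb.rinn_sub_rsmul_self _ _) (hc.rinn_sub_rsmul_self _ _))

lemma mem_closure_range_lsmul (x : restrictedDirectSum ψ ω) :
    x ∈ closure (Set.range fun e => lsmul ψ ω (star e) x) := by
  let _ := pullbackCStarAlgebra ψ ω
  refine mem_closure_range_of_norm_sq_eq (p := linn ψ ω x x) fun e => ?_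
  rw [linn_norm]
  exact congrArg norm
    (alg_ext_coord (hb.linn_sub_lsmul_self _ _) (hc.linn_sub_lsmul_self _ _))

variable (ψ ω)

/-- The restricted direct sum as a Hilbert bimodule over the pullback algebra. -/
def hilbertBimodule : HilbertBimodule (pullbackAlg ψ ω) (restrictedDirectSum ψ ω) where
  rsmul := rsmul ψ ω
  lsmul := lsmul ψ ω
  rinn := rinn ψ ω
  linn := linn ψ ω
  cstarA := (pullbackCStarAlgebra ψ ω).toCStarRing
  towerA := inferInstance
  smulCommA := inferInstance
  starModA := inferInstance
  completeA := (isClosed_pullbackAlg ψ ω).completeSpace_coe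
  completeX :=
    have := hb.completeX
    have := hc.completeX
    (isClosed_restrictedDirectSum ψ ω).completeSpace_coe
  rsmul_add_left _ _ _ := ext_coord (hb.rsmul_add_left _ _ _) (hc.rsmul_add_left _ _ _)
  rsmul_add_right _ _ _ := ext_coord (hb.rsmul_add_right _ _ _) (hc.rsmul_add_right _ _ _)
  rsmul_mul _ _ _ := ext_coord (hb.rsmul_mul _ _ _) (hc.rsmul_mul _ _ _)
  rsmul_smul_left _ _ _ := ext_coord (hb.rsmul_smul_left _ _ _) (hc.rsmul_smul_left _ _ _)
  rsmul_smul_right _ _ _ := ext_coord (hb.rsmul_smul_right _ _ _) (hc.rsmul_smul_right _ _ _)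
  lsmul_add_left _ _ _ := ext_coord (hb.lsmul_add_left _ _ _) (hc.lsmul_add_left _ _ _)
  lsmul_add_right _ _ _ := ext_coord (hb.lsmul_add_right _ _ _) (hc.lsmul_add_right _ _ _)
  lsmul_mul _ _ _ := ext_coord (hb.lsmul_mul _ _ _) (hc.lsmul_mul _ _ _)
  lsmul_smul_left _ _ _ := ext_coord (hb.lsmul_smul_left _ _ _) (hc.lsmul_smul_left _ _ _)
  lsmul_smul_right _ _ _ := ext_coord (hb.lsmul_smul_right _ _ _) (hc.lsmul_smul_right _ _ _)
  bimodule_assoc _ _ _ := ext_coord (hb.bimodule_assoc _ _ _) (hc.bimodule_assoc _ _ _)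
  rinn_add_right _ _ _ := alg_ext_coord (hb.rinn_add_right _ _ _) (hc.rinn_add_right _ _ _)
  rinn_smul_right _ _ _ := alg_ext_coord (hb.rinn_smul_right _ _ _) (hc.rinn_smul_right _ _ _)
  rinn_rsmul _ _ _ := alg_ext_coord (hb.rinn_rsmul _ _ _) (hc.rinn_rsmul _ _ _)
  rinn_star _ _ := alg_ext_coord (hb.rinn_star _ _) (hc.rinn_star _ _)
  rinn_nonneg _ := exists_eq_star_mul_self (hb.rinn_nonneg _) (hc.rinn_nonneg _)
  rinn_norm := rinn_norm
  linn_add_left _ _ _ := alg_ext_coord (hb.linn_add_left _ _ _) (hc.linn_add_left _ _ _)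
  linn_smul_left _ _ _ := alg_ext_coord (hb.linn_smul_left _ _ _) (hc.linn_smul_left _ _ _)
  linn_lsmul _ _ _ := alg_ext_coord (hb.linn_lsmul _ _ _) (hc.linn_lsmul _ _ _)
  linn_star _ _ := alg_ext_coord (hb.linn_star _ _) (hc.linn_star _ _)
  linn_nonneg _ := exists_eq_star_mul_self (hb.linn_nonneg _) (hc.linn_nonneg _)
  linn_norm := linn_norm
  compat _ _ _ := ext_coord (hb.compat _ _ _) (hc.compat _ _ _)
  rsmul_nondegenerate := Set.eq_univ_of_forall fun x =>
    closure_mono (Set.range_subset_iff.mpr fun e =>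
      Submodule.subset_span (Set.mem_ofPred.mpr ⟨x, e, rfl⟩))
      (mem_closure_range_rsmul x)
  lsmul_nondegenerate := Set.eq_univ_of_forall fun x =>
    closure_mono (Set.range_subset_iff.mpr fun e =>
      Submodule.subset_span (Set.mem_ofPred.mpr ⟨star e, x, rfl⟩))
      (mem_closure_range_lsmul x)

/-- The first coordinate projection as a morphism of Hilbert bimodules. -/
def fst : HBMorphism (hilbertBimodule ψ ω) hb where
  mapX := LinearMap.fst ℂ X Y ∘ₗ (restrictedDirectSum ψ ω).subtype
  mapA := (NonUnitalStarAlgHom.fst ℂ A B).comp (NonUnitalStarSubalgebraClass.subtype _)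
  map_rsmul _ _ := rfl
  map_lsmul _ _ := rfl
  map_rinn _ _ := rfl
  map_linn _ _ := rfl

/-- The second coordinate projection as a morphism of Hilbert bimodules. -/
def snd : HBMorphism (hilbertBimodule ψ ω) hc where
  mapX := LinearMap.snd ℂ X Y ∘ₗ (restrictedDirectSum ψ ω).subtype
  mapA := (NonUnitalStarAlgHom.snd ℂ A B).comp (NonUnitalStarSubalgebraClass.subtype _)
  map_rsmul _ _ := rfl
  map_lsmul _ _ := rfl
  map_rinn _ _ := rfl
  map_linn _ _ := rfl

end RestrictedDirectSum

end Pullback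

/-- Given Hilbert bimodules `(X, A)`, `(Y, B)`, `(Z, C)` and morphisms
`(ψ_X, ψ_A) : (X, A) → (Z, C)` and `(ω_Y, ω_B) : (Y, B) → (Z, C)`, the restricted direct
sum `X ⊕_Z Y` over the pullback C*-algebra `A ⊕_C B`, with coordinatewise actions and
inner products, is a Hilbert bimodule, and the coordinate projections are morphisms of
Hilbert bimodules. -/
theorem restricted_direct_sum_bimodule
    (hb : HilbertBimodule A X) (hc : HilbertBimodule B Y) (hz : HilbertBimodule C Z)
    (ψ : HBMorphism hb hz) (ω : HBMorphism hc hz) :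
    ∃ h : HilbertBimodule (pullbackAlg ψ ω) (restrictedDirectSum ψ ω),
      (∀ x p, (↑(h.rsmul x p) : X × Y) =
        (hb.rsmul (↑x : X × Y).1 (↑p : A × B).1, hc.rsmul (↑x : X × Y).2 (↑p : A × B).2)) ∧
      (∀ p x, (↑(h.lsmul p x) : X × Y) =
        (hb.lsmul (↑p : A × B).1 (↑x : X × Y).1, hc.lsmul (↑p : A × B).2 (↑x : X × Y).2)) ∧
      (∀ x y, (↑(h.rinn x y) : A × B) =
        (hb.rinn (↑x : X × Y).1 (↑y : X × Y).1, hc.rinn (↑x : X × Y).2 (↑y : X × Y).2)) ∧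
      (∀ x y, (↑(h.linn x y) : A × B) =
        (hb.linn (↑x : X × Y).1 (↑y : X × Y).1, hc.linn (↑x : X × Y).2 (↑y : X × Y).2)) ∧
      (∃ pX : HBMorphism h hb,
        (∀ x, pX.mapX x = (↑x : X × Y).1) ∧ (∀ p, pX.mapA p = (↑p : A × B).1)) ∧
      (∃ pY : HBMorphism h hc,
        (∀ x, pY.mapX x = (↑x : X × Y).2) ∧ (∀ p, pY.mapA p = (↑p : A × B).2)) := by
  exact ⟨RestrictedDirectSum.hilbertBimodule ψ ω, fun _ _ => rfl, fun _ _ => rfl, fun _ _ => rfl,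
    fun _ _ => rfl, ⟨RestrictedDirectSum.fst ψ ω, fun _ => rfl, fun _ => rfl⟩,
    ⟨RestrictedDirectSum.snd ψ ω, fun _ => rfl, fun _ => rfl⟩⟩

end RestrictedDirectSum
end
end

section
/- Let (e_i)_{i∈ℕ} be the standard orthonormal basis of the Hilbert space ℓ²(ℕ). For a bounded sequence λ: ℕ → ℂ, let W_λ ∈ B(ℓ²(ℕ)) be the weighted shift operator determined by W_λ e_i = λ(i)·e_{i+1}. Then the C*-subalgebra of B(ℓ²(ℕ)) generated by {W_λ : λ a bounded sequence} is strictly contained in B(ℓ²(ℕ)). -/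
noncomputable section

/-- The matrix entries of `T` with respect to the standard basis vanish at distance more than `k`
from the diagonal. -/
def HasBandwidth (T : lp (fun _ : ℕ => ℂ) 2 →L[ℂ] lp (fun _ : ℕ => ℂ) 2) (k : ℕ) : Prop :=
  ∀ i j : ℕ, i + k < j ∨ j + k < i → T (lp.single 2 j 1) i = 0

lemma star_apply_single_apply (T : lp (fun _ : ℕ => ℂ) 2 →L[ℂ] lp (fun _ : ℕ => ℂ) 2)
    (i j : ℕ) : (star T) (lp.single 2 j 1) i = star (T (lp.single 2 i 1) j) := by
  have h := ContinuousLinearMap.adjoint_inner_right T (lp.single 2 i 1) (lp.single 2 j 1)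
  rw [lp.inner_single_left, lp.inner_single_right] at h
  simpa [ContinuousLinearMap.star_eq_adjoint] using h

namespace HasBandwidth

variable {S T : lp (fun _ : ℕ => ℂ) 2 →L[ℂ] lp (fun _ : ℕ => ℂ) 2} {k m : ℕ}

lemma star (hT : HasBandwidth T k) : HasBandwidth (star T) k := by
  intro i j hij
  rw [star_apply_single_apply, hT j i hij.symm, star_zero]

lemma add (hS : HasBandwidth S k) (hT : HasBandwidth T m) : HasBandwidth (S + T) (k + m) := by
  intro i j hij
  have h₁ := hS i j (by omega)
  have h₂ := hT i j (by omega)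
  simp [h₁, h₂]

lemma mul (hS : HasBandwidth S k) (hT : HasBandwidth T m) : HasBandwidth (S * T) (k + m) := by
  intro i j hij
  have h := ContinuousLinearMap.adjoint_inner_left S (T (lp.single 2 j 1)) (lp.single 2 i 1)
  rw [lp.inner_single_left, lp.inner_eq_tsum, ← ContinuousLinearMap.star_eq_adjoint] at h
  have hzero : ∀ n : ℕ,
      inner ℂ ((Star.star S) (lp.single 2 i 1) n) (T (lp.single 2 j 1) n) = 0 := by
    intro n
    by_cases hn : n + m < j ∨ j + m < n
    · rw [hT n j hn, inner_zero_right]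
    · rw [hS.star n i (by omega), inner_zero_left]
  simp only [hzero, tsum_zero] at h
  simpa using h.symm

lemma algebraMap (c : ℂ) : HasBandwidth (algebraMap ℂ _ c) 0 := by
  intro i j hij
  have hne : i ≠ j := by omega
  simp [Algebra.algebraMap_eq_smul_one, lp.single_apply, hne]

end HasBandwidth

/-- There is a bounded operator on `ℓ²(ℕ)` sending `e n` to `e (2 * n)`. -/
lemma exists_map_single_two_mul : ∃ T : lp (fun _ : ℕ => ℂ) 2 →L[ℂ] lp (fun _ : ℕ => ℂ) 2,
    ∀ n : ℕ, T (lp.single 2 n 1) = lp.single 2 (2 * n) 1 := by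
  have hv : Orthonormal ℂ fun n : ℕ => (lp.single 2 (2 * n) 1 : lp (fun _ : ℕ => ℂ) 2) := by
    rw [orthonormal_iff_ite]
    intro i j
    rw [lp.inner_single_left]
    simp [lp.single_apply, Pi.single_apply]
  refine ⟨hv.orthogonalFamily.linearIsometry.toContinuousLinearMap, fun n => ?_⟩
  simp [OrthogonalFamily.linearIsometry_apply_single]

/-- **Statement 17.** Let `(e i)` be the standard orthonormal basis of `ℓ²(ℕ)`.  For a
bounded sequence `λ : ℕ → ℂ` let `W_λ` be the weighted shift operator determined by
`W_λ (e i) = λ i • e (i+1)`.  Then the C*-subalgebra of `B(ℓ²(ℕ))` generated by the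
weighted shift operators is strictly contained in `B(ℓ²(ℕ))`. -/
theorem weighted_shift_algebra_proper :
    (StarAlgebra.adjoin ℂ
      {W : lp (fun _ : ℕ => ℂ) 2 →L[ℂ] lp (fun _ : ℕ => ℂ) 2 |
        ∃ l : ℕ → ℂ, (∃ C : ℝ, ∀ i : ℕ, ‖l i‖ ≤ C) ∧
          ∀ i : ℕ, W (lp.single 2 i 1) =
            l i • lp.single 2 (i + 1) 1}).topologicalClosure ≠ ⊤ := by
  intro htop
  obtain ⟨T, hT⟩ := exists_map_single_two_mul
  have hmem := htop ▸ (StarSubalgebra.mem_top : T ∈ (⊤ : StarSubalgebra ℂ _))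
  rw [← SetLike.mem_coe, StarSubalgebra.topologicalClosure_coe, Metric.mem_closure_iff] at hmem
  obtain ⟨S, hS, hdist⟩ := hmem 1 one_pos
  obtain ⟨k, hk⟩ : ∃ k, HasBandwidth S k := by
    clear hdist
    induction hS using StarAlgebra.adjoin_induction with
    | mem W hW =>
      obtain ⟨l, -, hl⟩ := hW
      refine ⟨1, fun i j hij => ?_⟩
      have hne : i ≠ j + 1 := by omega
      simp [hl, lp.single_apply, hne]
    | algebraMap c => exact ⟨0, .algebraMap c⟩
    | add A B _ _ hA hB => exact ⟨_, hA.choose_spec.add hB.choose_spec⟩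
    | mul A B _ _ hA hB => exact ⟨_, hA.choose_spec.mul hB.choose_spec⟩
    | star A _ hA => exact ⟨_, hA.choose_spec.star⟩
  have hentry : (T - S) (lp.single 2 (k + 1) 1) (2 * (k + 1)) = 1 := by
    simp [hT, hk (2 * (k + 1)) (k + 1) (by omega)]
  have hle : (1 : ℝ) ≤ ‖T - S‖ := calc
    (1 : ℝ) = ‖(T - S) (lp.single 2 (k + 1) 1) (2 * (k + 1))‖ := by rw [hentry, norm_one]
    _ ≤ ‖(T - S) (lp.single 2 (k + 1) 1)‖ := lp.norm_apply_le_norm two_ne_zero _ _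
    _ ≤ ‖T - S‖ * ‖(lp.single 2 (k + 1) 1 : lp (fun _ : ℕ => ℂ) 2)‖ := (T - S).le_opNorm _
    _ = ‖T - S‖ := by rw [lp.norm_single (by norm_num), norm_one, mul_one]
  exact absurd hdist (by rw [dist_eq_norm]; exact hle.not_gt)
end
end
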